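/- In a regular pentagon, every triangle whose vertices are three of the pentagon's five vertices has area at most 1/√5 times the area of the pentagon, and some such triangle attains this ratio. (Hence f_5(3) = 1/√5.) -/

import Mathlib

open MeasureTheory

/-- The area of a planar point set: the Lebesgue measure of its convex hull. -/
noncomputable def area (S : Set (ℝ × ℝ)) : ℝ :=
  (volume (convexHull ℝ S)).toReal

/-- Twice the signed area of the triangle `a b x`. -/
def cross (a b x : ℝ × ℝ) : ℝ :=
  (b.1 - a.1) * (x.2 - a.2) - (b.2 - a.2) * (x.1 - a.1)

lemma cross_swap (a b x : ℝ × ℝ) : cross b a x = -cross a b x := by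
  unfold cross; ring

lemma cross_rotate (a b x : ℝ × ℝ) : cross b x a = cross a b x := by
  unfold cross; ring

lemma cross_self_left (a b : ℝ × ℝ) : cross a b a = 0 := by
  unfold cross; ring

lemma cross_self_right (a b : ℝ × ℝ) : cross a b b = 0 := by
  unfold cross; ring

lemma convex_cross_nonneg (a b : ℝ × ℝ) : Convex ℝ {x | 0 ≤ cross a b x} := by
  intro x hx y hy s t hs ht hst
  have h : cross a b (s • x + t • y) = s * cross a b x + t * cross a b y := by
    obtain rfl : s = 1 - t := by linarith
    simp only [cross, Prod.fst_add, Prod.snd_add, Prod.smul_fst, Prod.smul_snd, smul_eq_mul]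
    ring
  simp only [Set.mem_ofPred_eq] at hx hy ⊢
  rw [h]
  positivity

lemma cross_nonneg_of_mem_convexHull {a b x : ℝ × ℝ} {S : Set (ℝ × ℝ)}
    (hS : ∀ y ∈ S, 0 ≤ cross a b y) (hx : x ∈ convexHull ℝ S) : 0 ≤ cross a b x :=
  convexHull_min hS (convex_cross_nonneg a b) hx

lemma mem_convexHull_triangle {a b c x : ℝ × ℝ} (h : 0 < cross a b c)
    (hab : 0 ≤ cross a b x) (hbc : 0 ≤ cross b c x) (hca : 0 ≤ cross c a x) :
    x ∈ convexHull ℝ {a, b, c} := by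
  have hsum : cross b c x + cross c a x + cross a b x = cross a b c := by
    unfold cross; ring
  have hx : x = ∑ i, (![cross b c x, cross c a x, cross a b x] i / cross a b c) •
      (![a, b, c] : Fin 3 → ℝ × ℝ) i := by
    have h' := h.ne'
    simp only [Fin.sum_univ_three, Matrix.cons_val]
    ext <;> simp only [Prod.fst_add, Prod.snd_add, Prod.smul_fst, Prod.smul_snd, smul_eq_mul] <;>
      field_simp <;> unfold cross <;> ring
  rw [hx]
  refine (convex_convexHull ℝ _).sum_mem ?_ ?_ ?_
  · intro i _
    fin_cases i <;> simp <;> positivity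
  · simp only [Fin.sum_univ_three, Matrix.cons_val]
    rw [← add_div, ← add_div, hsum, div_self h.ne']
  · intro i _
    apply subset_convexHull
    fin_cases i <;> simp

open scoped Pointwise in
/-- Areas of triangles are proportional to the absolute value of `cross`. -/
lemma area_triangle (a b c : ℝ × ℝ) :
    area {a, b, c} = |cross a b c| * area {0, (1, 0), (0, 1)} := by
  let L : ℝ × ℝ →ₗ[ℝ] ℝ × ℝ :=
    Matrix.toLin (Module.Basis.finTwoProd ℝ) (Module.Basis.finTwoProd ℝ)
      !![b.1 - a.1, c.1 - a.1; b.2 - a.2, c.2 - a.2]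
  have hdet : LinearMap.det L = cross a b c := by
    simp only [L, LinearMap.det_toLin, Matrix.det_fin_two_of, cross]
    ring
  have himage : ({a, b, c} : Set (ℝ × ℝ)) = ({a} : Set (ℝ × ℝ)) + L '' {0, (1, 0), (0, 1)} := by
    have hadd : ∀ x : ℝ × ℝ, a + (x.1 - a.1, x.2 - a.2) = x := fun x => by
      ext <;> simp
    have hzero : a + (0, 0) = a := add_zero a
    simp [L, Set.image_insert_eq, Matrix.toLin_finTwoProd_apply, hadd, hzero]
  unfold area
  rw [himage, convexHull_add, convexHull_singleton, ← L.image_convexHull,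
    Set.singleton_add, Set.image_add_left, measure_preimage_add,
    Measure.addHaar_image_linearMap, hdet, ENNReal.toReal_mul,
    ENNReal.toReal_ofReal (abs_nonneg _)]

lemma volume_setOf_cross_eq_zero {a b : ℝ × ℝ} (h : a ≠ b) :
    volume {x | cross a b x = 0} = 0 := by
  let f : ℝ × ℝ →ₗ[ℝ] ℝ :=
    (b.1 - a.1) • LinearMap.snd ℝ ℝ ℝ - (b.2 - a.2) • LinearMap.fst ℝ ℝ ℝ
  have hf : LinearMap.ker f ≠ ⊤ := by
    intro htop
    rw [LinearMap.ker_eq_top] at htop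
    have h1 := LinearMap.congr_fun htop (1, 0)
    have h2 := LinearMap.congr_fun htop (0, 1)
    simp [f, sub_eq_zero] at h1 h2
    exact h (Prod.ext h2.symm h1)
  have hset : {x | cross a b x = 0} = (fun x => -a + x) ⁻¹' (LinearMap.ker f : Set (ℝ × ℝ)) := by
    ext x
    simp only [cross, Set.mem_ofPred_eq, Set.mem_preimage, SetLike.mem_coe, LinearMap.mem_ker, f,
      LinearMap.sub_apply, LinearMap.smul_apply, LinearMap.fst_apply, LinearMap.snd_apply,
      smul_eq_mul, Prod.fst_add, Prod.snd_add, Prod.fst_neg, Prod.snd_neg]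
    ring_nf
  rw [hset, measure_preimage_add]
  exact Measure.addHaar_submodule _ _ hf

lemma ne_of_cross_pos {a b c : ℝ × ℝ} (h : 0 < cross a b c) : a ≠ b := by
  rintro rfl
  simp [cross] at h

lemma aedisjoint_of_cross {a b : ℝ × ℝ} (hab : a ≠ b) {S T : Set (ℝ × ℝ)}
    (hS : ∀ x ∈ S, cross a b x ≤ 0) (hT : ∀ x ∈ T, 0 ≤ cross a b x) :
    AEDisjoint volume S T :=
  measure_mono_null (fun x hx => le_antisymm (hS x hx.1) (hT x hx.2))
    (volume_setOf_cross_eq_zero hab)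

/-- A convex pentagon is cut by the diagonals from one vertex into three triangles. -/
lemma area_convex_pentagon (p : Fin 5 → ℝ × ℝ)
    (hp : ∀ i j k, i < j → j < k → 0 < cross (p i) (p j) (p k)) :
    area (Set.range p) =
      area {p 0, p 1, p 2} + area {p 0, p 2, p 3} + area {p 0, p 3, p 4} := by
  have h012 := hp 0 1 2 (by decide) (by decide)
  have h023 := hp 0 2 3 (by decide) (by decide)
  have h024 := hp 0 2 4 (by decide) (by decide)
  have h034 := hp 0 3 4 (by decide) (by decide)
  have hedge : ∀ i, ∀ x ∈ convexHull ℝ (Set.range p), 0 ≤ cross (p i) (p (i + 1)) x := by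
    intro i x hx
    refine cross_nonneg_of_mem_convexHull ?_ hx
    rintro _ ⟨k, rfl⟩
    have hcases : k = i ∨ k = i + 1 ∨ (i < i + 1 ∧ i + 1 < k) ∨ (k < i ∧ i < i + 1) ∨
        (i + 1 < k ∧ k < i) := by
      revert i k; decide
    rcases hcases with rfl | rfl | h | h | h
    · exact (cross_self_left _ _).ge
    · exact (cross_self_right _ _).ge
    · exact (hp _ _ _ h.1 h.2).le
    · rw [cross_rotate]
      exact (hp _ _ _ h.1 h.2).le
    · rw [← cross_rotate]
      exact (hp _ _ _ h.1 h.2).le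
  have hleft : ∀ x ∈ convexHull ℝ {p 0, p 1, p 2}, cross (p 0) (p 2) x ≤ 0 := by
    intro x hx
    rw [← neg_nonneg, ← cross_swap]
    refine cross_nonneg_of_mem_convexHull ?_ hx
    rintro y (rfl | rfl | rfl)
    · exact (cross_self_right _ _).ge
    · rw [← cross_rotate]
      exact h012.le
    · exact (cross_self_left _ _).ge
  have hmid : ∀ x ∈ convexHull ℝ {p 0, p 2, p 3},
      0 ≤ cross (p 0) (p 2) x ∧ cross (p 0) (p 3) x ≤ 0 := by
    intro x hx
    constructor
    · refine cross_nonneg_of_mem_convexHull ?_ hx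
      rintro y (rfl | rfl | rfl)
      · exact (cross_self_left _ _).ge
      · exact (cross_self_right _ _).ge
      · exact h023.le
    · rw [← neg_nonneg, ← cross_swap]
      refine cross_nonneg_of_mem_convexHull ?_ hx
      rintro y (rfl | rfl | rfl)
      · exact (cross_self_right _ _).ge
      · rw [← cross_rotate]
        exact h023.le
      · exact (cross_self_left _ _).ge
  have hright : ∀ x ∈ convexHull ℝ {p 0, p 3, p 4},
      0 ≤ cross (p 0) (p 2) x ∧ 0 ≤ cross (p 0) (p 3) x := by
    intro x hx
    constructor
    · refine cross_nonneg_of_mem_convexHull ?_ hx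
      rintro y (rfl | rfl | rfl)
      · exact (cross_self_left _ _).ge
      · exact h023.le
      · exact h024.le
    · refine cross_nonneg_of_mem_convexHull ?_ hx
      rintro y (rfl | rfl | rfl)
      · exact (cross_self_left _ _).ge
      · exact (cross_self_right _ _).ge
      · exact h034.le
  have hunion : convexHull ℝ (Set.range p) =
      convexHull ℝ {p 0, p 1, p 2} ∪
        (convexHull ℝ {p 0, p 2, p 3} ∪ convexHull ℝ {p 0, p 3, p 4}) := by
    apply Set.Subset.antisymm
    · intro x hx
      rcases le_total (cross (p 0) (p 2) x) 0 with h2 | h2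
      · refine Or.inl (mem_convexHull_triangle h012 (hedge 0 x hx) (hedge 1 x hx) ?_)
        rw [cross_swap]
        linarith
      · rcases le_total (cross (p 0) (p 3) x) 0 with h3 | h3
        · refine Or.inr (Or.inl (mem_convexHull_triangle h023 h2 (hedge 2 x hx) ?_))
          rw [cross_swap]
          linarith
        · exact Or.inr (Or.inr (mem_convexHull_triangle h034 h3 (hedge 3 x hx) (hedge 4 x hx)))
    · have hsub : ∀ i j k, convexHull ℝ {p i, p j, p k} ⊆ convexHull ℝ (Set.range p) := by
        intro i j k
        apply convexHull_mono
        rintro y (rfl | rfl | rfl) <;> exact Set.mem_range_self _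
      exact Set.union_subset (hsub _ _ _) (Set.union_subset (hsub _ _ _) (hsub _ _ _))
  have hcompact : ∀ a b c : ℝ × ℝ, IsCompact (convexHull ℝ {a, b, c}) :=
    fun a b c => (Set.toFinite {a, b, c}).isCompact_convexHull ℝ
  have hmeas : ∀ a b c : ℝ × ℝ, NullMeasurableSet (convexHull ℝ {a, b, c}) volume :=
    fun a b c => (hcompact a b c).measurableSet.nullMeasurableSet
  have hfin : ∀ a b c : ℝ × ℝ, volume (convexHull ℝ {a, b, c}) ≠ ⊤ :=
    fun a b c => (hcompact a b c).measure_ne_top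
  unfold area
  rw [hunion, measure_union₀ ((hmeas _ _ _).union (hmeas _ _ _)), measure_union₀ (hmeas _ _ _),
    ENNReal.toReal_add (hfin _ _ _) (ENNReal.add_ne_top.2 ⟨hfin _ _ _, hfin _ _ _⟩),
    ENNReal.toReal_add (hfin _ _ _) (hfin _ _ _), add_assoc]
  · exact aedisjoint_of_cross (ne_of_cross_pos h034) (fun x hx => (hmid x hx).2)
      (fun x hx => (hright x hx).2)
  · refine aedisjoint_of_cross (ne_of_cross_pos h023) hleft ?_
    rintro x (hx | hx)
    · exact (hmid x hx).1
    · exact (hright x hx).1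

lemma cross_circle (c : ℝ × ℝ) (R α β γ : ℝ) :
    cross (c.1 + R * Real.cos α, c.2 + R * Real.sin α)
      (c.1 + R * Real.cos β, c.2 + R * Real.sin β)
      (c.1 + R * Real.cos γ, c.2 + R * Real.sin γ) =
    R ^ 2 * (Real.sin (β - α) + Real.sin (γ - β) - Real.sin (γ - α)) := by
  simp only [cross, Real.sin_sub]
  ring

lemma cos_two_pi_div_five : Real.cos (2 * Real.pi / 5) = (√5 - 1) / 4 := by
  have h5 : √5 ^ 2 = 5 := Real.sq_sqrt (by norm_num)
  rw [mul_div_assoc, Real.cos_two_mul, Real.cos_pi_div_five]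
  linear_combination h5 / 8

lemma sin_four_pi_div_five :
    Real.sin (4 * Real.pi / 5) = (√5 - 1) / 2 * Real.sin (2 * Real.pi / 5) := by
  rw [show 4 * Real.pi / 5 = 2 * (2 * Real.pi / 5) by ring, Real.sin_two_mul,
    cos_two_pi_div_five]
  ring

lemma sin_six_pi_div_five :
    Real.sin (6 * Real.pi / 5) = -((√5 - 1) / 2 * Real.sin (2 * Real.pi / 5)) := by
  rw [← sin_four_pi_div_five, ← Real.sin_neg, ← Real.sin_add_two_pi (-_)]
  ring_nf

lemma sin_eight_pi_div_five :
    Real.sin (8 * Real.pi / 5) = -Real.sin (2 * Real.pi / 5) := by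
  rw [← Real.sin_neg, ← Real.sin_add_two_pi (-_)]
  ring_nf

/-- The first case of the conclusion is that of three consecutive vertices. -/
lemma cross_regular_pentagon (c : ℝ × ℝ) (R θ : ℝ) (p : Fin 5 → ℝ × ℝ)
    (hp : ∀ k : Fin 5, p k =
      (c.1 + R * Real.cos (2 * Real.pi * (k.val : ℝ) / 5 + θ),
       c.2 + R * Real.sin (2 * Real.pi * (k.val : ℝ) / 5 + θ)))
    (i j k : Fin 5) (hij : i < j) (hjk : j < k) :
    cross (p i) (p j) (p k) = R ^ 2 * Real.sin (2 * Real.pi / 5) *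
      if (k.val = i.val + 2 ∨ (j.val = i.val + 1 ∧ k.val = i.val + 4) ∨
        (j.val = i.val + 3)) then (5 - √5) / 2 else √5 := by
  have hsin : ∀ m n : Fin 5, m < n →
      Real.sin ((2 * Real.pi * (n.val : ℝ) / 5 + θ) - (2 * Real.pi * (m.val : ℝ) / 5 + θ)) =
        ![0, Real.sin (2 * Real.pi / 5), (√5 - 1) / 2 * Real.sin (2 * Real.pi / 5),
          -((√5 - 1) / 2 * Real.sin (2 * Real.pi / 5)), -Real.sin (2 * Real.pi / 5)] (n - m) := by
    intro m n hmn
    have hval : ((n - m : Fin 5).val : ℝ) = n.val - m.val := by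
      rw [Fin.sub_val_of_le hmn.le, Nat.cast_sub hmn.le]
    have harg : (2 * Real.pi * (n.val : ℝ) / 5 + θ) - (2 * Real.pi * (m.val : ℝ) / 5 + θ) =
        2 * Real.pi * ((n - m : Fin 5).val : ℝ) / 5 := by
      rw [hval]; ring
    rw [harg, ← sin_six_pi_div_five, ← sin_four_pi_div_five, ← sin_eight_pi_div_five]
    generalize n - m = d
    fin_cases d <;> simp <;> ring_nf
  rw [hp, hp, hp, cross_circle, hsin _ _ hij, hsin _ _ hjk, hsin _ _ (hij.trans hjk)]
  fin_cases i <;> fin_cases j <;> first | (exact absurd hij (by decide)) | skip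
  all_goals fin_cases k <;> first | (exact absurd hjk (by decide)) | skip
  all_goals simp
  all_goals ring

/-- In a regular pentagon, every triangle on three of the five vertices has area
at most `1/√5` times the area of the pentagon, and some triangle attains this ratio. -/
theorem regular_pentagon_triangle_ratio
    (c : ℝ × ℝ) (R θ : ℝ) (hR : 0 < R) (p : Fin 5 → ℝ × ℝ)
    (hp : ∀ k : Fin 5, p k =
      (c.1 + R * Real.cos (2 * Real.pi * (k.val : ℝ) / 5 + θ),
       c.2 + R * Real.sin (2 * Real.pi * (k.val : ℝ) / 5 + θ))) :
    (∀ s : Finset (Fin 5), s.card = 3 →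
      area (p '' ↑s) ≤ (1 / Real.sqrt 5) * area (Set.range p)) ∧
    (∃ s : Finset (Fin 5), s.card = 3 ∧
      area (p '' ↑s) = (1 / Real.sqrt 5) * area (Set.range p)) := by
  have hcross := cross_regular_pentagon c R θ p hp
  have h5 : √5 ^ 2 = 5 := Real.sq_sqrt (by norm_num)
  have h5_pos : 0 < √5 := by positivity
  have h5_le : (5 - √5) / 2 ≤ √5 := by nlinarith
  have h5_lt : 0 < (5 - √5) / 2 := by nlinarith
  have hsin : 0 < Real.sin (2 * Real.pi / 5) :=
    Real.sin_pos_of_pos_of_lt_pi (by positivity) (by linarith [Real.pi_pos])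
  set K := R ^ 2 * Real.sin (2 * Real.pi / 5)
  have hK : 0 < K := by positivity
  set τ := area {0, (1, 0), (0, 1)}
  have hτ : 0 ≤ τ := ENNReal.toReal_nonneg
  have hpos : ∀ i j k, i < j → j < k → 0 < cross (p i) (p j) (p k) := by
    intro i j k hij hjk
    rw [hcross i j k hij hjk]
    split_ifs <;> positivity
  have harea : ∀ i j k, i < j → j < k →
      area {p i, p j, p k} = cross (p i) (p j) (p k) * τ := by
    intro i j k hij hjk
    rw [area_triangle, abs_of_pos (hpos i j k hij hjk)]
  have hmax : 1 / √5 * area (Set.range p) = K * √5 * τ := by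
    rw [area_convex_pentagon p hpos, harea 0 1 2 (by decide) (by decide),
      harea 0 2 3 (by decide) (by decide), harea 0 3 4 (by decide) (by decide),
      hcross 0 1 2 (by decide) (by decide), hcross 0 2 3 (by decide) (by decide),
      hcross 0 3 4 (by decide) (by decide)]
    simp
    field_simp
    rw [h5]
    ring
  rw [hmax]
  refine ⟨fun s hs => ?_, {0, 2, 3}, rfl, ?_⟩
  · obtain ⟨i, j, k, hij, hjk, rfl⟩ : ∃ i j k, i < j ∧ j < k ∧ s = {i, j, k} := by
      revert s; decide
    simp only [Finset.coe_insert, Finset.coe_singleton, Set.image_insert_eq, Set.image_singleton]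
    rw [harea i j k hij hjk, hcross i j k hij hjk]
    gcongr
    split_ifs
    · exact h5_le
    · exact le_rfl
  · simp only [Finset.coe_insert, Finset.coe_singleton, Set.image_insert_eq, Set.image_singleton]
    rw [harea 0 2 3 (by decide) (by decide), hcross 0 2 3 (by decide) (by decide)]
    simp
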